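/- arXiv:2205.14387 — 2 statements merged into one kernel-verified Lean document; each statement's English description precedes it below -/
import Mathlib

section
/- If (d,u,v) is stable and some pair (i,j) ∈ d has x(i) = x and y(j) = y, then U_{xy} + V_{xy} = Φ_{xy} − w_{z(y)}. -/
/-- If `(d,u,v)` is stable and some pair `(i,j) ∈ d` has types `x(i) = x` and `y(j) = y`,
then `U_{xy} + V_{xy} = Φ_{xy} − w_{z(y)}`. -/
theorem stmt2 {I J X Y Z : Type*} [Fintype I] [Fintype J] [Fintype X] [Fintype Y] [Fintype Z]
    [Nonempty I] [Nonempty J]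
    (xm : I → X) (ym : J → Y) (zm : Y → Z)
    (hxm : Function.Surjective xm) (hym : Function.Surjective ym)
    -- a matching: each worker and each slot appears in at most one pair
    (d : Finset (I × J))
    (hd₁ : ∀ p ∈ d, ∀ q ∈ d, p.1 = q.1 → p = q)
    (hd₂ : ∀ p ∈ d, ∀ q ∈ d, p.2 = q.2 → p = q)
    (u : I → ℝ) (v : J → ℝ) (Φt : I → J → ℝ)
    (ε : I → Option Y → ℝ) (η : X → J → ℝ)
    (w : Z → ℝ) (Φ : X → Y → ℝ)
    -- systematic utilities
    (U : X → Option Y → ℝ) (V : X → Y → ℝ)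
    (hU : ∀ x y, IsLeast {r : ℝ | ∃ i, xm i = x ∧ r = u i - ε i y} (U x y))
    (hV : ∀ x y, IsLeast {r : ℝ | ∃ j, ym j = y ∧ r = v j - η x j} (V x y))
    -- additive separability
    (hsep : ∀ i j, Φt i j = Φ (xm i) (ym j) - w (zm (ym j)) + ε i (some (ym j)) + η (xm i) j)
    -- stability
    (hIRu : ∀ i, 0 ≤ u i) (hIRu0 : ∀ i, (∀ j, (i, j) ∉ d) → u i = 0)
    (hIRv : ∀ j, 0 ≤ v j) (hIRv0 : ∀ j, (∀ i, (i, j) ∉ d) → v j = 0)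
    (hNB : ∀ i j, u i + v j ≥ Φt i j)
    (hNBeq : ∀ i j, (i, j) ∈ d → u i + v j = Φt i j) :
    ∀ (x : X) (y : Y), (∃ i j, (i, j) ∈ d ∧ xm i = x ∧ ym j = y) →
      U x (some y) + V x y = Φ x y - w (zm y) := by
  rintro x y ⟨i, j, hij, hx, hy⟩
  obtain ⟨i', hi', hUi⟩ := (hU x (some y)).1
  obtain ⟨j', hj', hVj⟩ := (hV x y).1
  have h1 := (hU x (some y)).2 ⟨i, hx, rfl⟩
  have h2 := (hV x y).2 ⟨j, hy, rfl⟩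
  have h3 := hNBeq i j hij
  have h4 := hNB i' j'
  rw [hsep, hx, hy] at h3
  rw [hsep, hi', hj'] at h4
  linarith
end

section
/- (Existence part of Corollary 1) Assume the regional constraints are strictly feasible: there exists a matching μ : T → ℝ with μ_{xy} > 0 for all (x,y) ∈ T satisfying the population constraint (Σ_{y∈Y₀} μ_{xy} = n_x for all x ∈ X and Σ_{x∈X₀} μ_{xy} = m_y for all y ∈ Y) and the regional constraint (o̲_z ≤ Σ_{x∈X} Σ_{y : z(y)=z} μ_{xy} ≤ ō_z for all z ∈ Z). Then an efficient aggregate equilibrium exists. -/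
open MeasureTheory

noncomputable section

variable {X Y Z : Type*} [Fintype X] [Fintype Y] [Fintype Z] [DecidableEq Z]
  [Nonempty X] [Nonempty Y]

/-- Extension `Û` of systematic utilities: the outside option `y₀` (encoded `none`)
gets utility `0`. -/
def Uhat (U : X → Y → ℝ) (x : X) (o : Option Y) : ℝ := o.elim 0 (U x)

/-- Extension `V̂` of systematic utilities: the outside option `x₀` (encoded `none`)
gets utility `0`. -/
def Vhat (V : X → Y → ℝ) (y : Y) (o : Option X) : ℝ := o.elim 0 (fun x => V x y)

/-- Worker-side welfare `G(U) = Σ_x n_x ∫ max_{y ∈ Y₀} (Û_{xy} + ε_y) dP_x(ε)`. -/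
def Gfun (n : X → ℝ) (P : X → Measure (Option Y → ℝ)) (U : X → Y → ℝ) : ℝ :=
  ∑ x, n x * ∫ ε, (Finset.univ.sup' Finset.univ_nonempty
    fun y : Option Y => Uhat U x y + ε y) ∂(P x)

/-- Slot-side welfare `H(V) = Σ_y m_y ∫ max_{x ∈ X₀} (V̂_{xy} + η_x) dQ_y(η)`. -/
def Hfun (m : Y → ℝ) (Q : Y → Measure (Option X → ℝ)) (V : X → Y → ℝ) : ℝ :=
  ∑ y, m y * ∫ η, (Finset.univ.sup' Finset.univ_nonempty
    fun x : Option X => Vhat V y x + η x) ∂(Q y)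

/-- Choice probability `p_x(y; U)` of a type-`x` worker choosing alternative `y ∈ Y₀`. -/
def cp (P : X → Measure (Option Y → ℝ)) (U : X → Y → ℝ) (x : X) (y : Option Y) : ℝ :=
  ((P x) {ε | ∀ y', y' ≠ y → Uhat U x y' + ε y' < Uhat U x y + ε y}).toReal

/-- Choice probability `q_y(x; V)` of a type-`y` slot choosing alternative `x ∈ X₀`. -/
def cq (Q : Y → Measure (Option X → ℝ)) (V : X → Y → ℝ) (y : Y) (x : Option X) : ℝ :=
  ((Q y) {η | ∀ x', x' ≠ x → Vhat V y x' + η x' < Vhat V y x + η x}).toReal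

/-- Population constraint of a matching `μ : T → ℝ` (with `T = X₀ × Y₀ ∖ {(x₀,y₀)}`,
encoded as `μ : Option X → Option Y → ℝ` with the `(none, none)` entry irrelevant). -/
def PopCon (n : X → ℝ) (m : Y → ℝ) (μ : Option X → Option Y → ℝ) : Prop :=
  (∀ x, ∑ o : Option Y, μ (some x) o = n x) ∧ (∀ y, ∑ o : Option X, μ o (some y) = m y)

/-- Total mass of matches in region `z`. -/
def regionMass (zm : Y → Z) (μ : Option X → Option Y → ℝ) (z : Z) : ℝ :=
  ∑ x : X, ∑ y : Y, if zm y = z then μ (some x) (some y) else 0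

/-- Regional constraint: each region's mass lies between its floor and ceiling. -/
def RegionCon (zm : Y → Z) (ol ou : Z → ℝ) (μ : Option X → Option Y → ℝ) : Prop :=
  ∀ z, ol z ≤ regionMass zm μ z ∧ regionMass zm μ z ≤ ou z

/-- Market clearing: `μ_{xy} = n_x p_x(y;U) = m_y q_y(x;V)` (with the obvious one-sided
conditions for the outside options). -/
def MarketClearing (n : X → ℝ) (m : Y → ℝ) (P : X → Measure (Option Y → ℝ))
    (Q : Y → Measure (Option X → ℝ)) (μ : Option X → Option Y → ℝ)
    (U V : X → Y → ℝ) : Prop :=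
  (∀ x y, μ (some x) (some y) = n x * cp P U x (some y) ∧
    μ (some x) (some y) = m y * cq Q V y (some x)) ∧
  (∀ x, μ (some x) none = n x * cp P U x none) ∧
  (∀ y, μ none (some y) = m y * cq Q V y none)

/-- Aggregate equilibrium with regional constraints. -/
def IsAE (n : X → ℝ) (m : Y → ℝ) (P : X → Measure (Option Y → ℝ))
    (Q : Y → Measure (Option X → ℝ)) (Φ : X → Y → ℝ) (zm : Y → Z) (ol ou : Z → ℝ)
    (μ : Option X → Option Y → ℝ) (U V : X → Y → ℝ) (w : Z → ℝ) : Prop :=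
  PopCon n m μ ∧
  (∀ x y, U x y + V x y ≥ Φ x y - w (zm y)) ∧
  MarketClearing n m P Q μ U V ∧
  RegionCon zm ol ou μ

/-- Efficient aggregate equilibrium: an AE satisfying complementary slackness. -/
def IsEAE (n : X → ℝ) (m : Y → ℝ) (P : X → Measure (Option Y → ℝ))
    (Q : Y → Measure (Option X → ℝ)) (Φ : X → Y → ℝ) (zm : Y → Z) (ol ou : Z → ℝ)
    (μ : Option X → Option Y → ℝ) (U V : X → Y → ℝ) (w : Z → ℝ) : Prop :=
  IsAE n m P Q Φ zm ol ou μ U V w ∧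
  ∀ z, (0 < w z → regionMass zm μ z = ou z) ∧ (w z < 0 → regionMass zm μ z = ol z)

/-- Feasibility for problem (D). -/
def FeasD (Φ : X → Y → ℝ) (zm : Y → Z) (U V : X → Y → ℝ) (wb wl : Z → ℝ) : Prop :=
  (∀ z, 0 ≤ wb z) ∧ (∀ z, 0 ≤ wl z) ∧
  ∀ x y, U x y + V x y ≥ Φ x y - wb (zm y) + wl (zm y)

/-- Objective of problem (D). -/
def objD (n : X → ℝ) (m : Y → ℝ) (P : X → Measure (Option Y → ℝ))
    (Q : Y → Measure (Option X → ℝ)) (ol ou : Z → ℝ)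
    (U V : X → Y → ℝ) (wb wl : Z → ℝ) : ℝ :=
  Gfun n P U + Hfun m Q V + ∑ z, ou z * wb z - ∑ z, ol z * wl z

/-- Optimality for problem (D): feasible and minimizing the objective among
feasible points. -/
def IsOptD (n : X → ℝ) (m : Y → ℝ) (P : X → Measure (Option Y → ℝ))
    (Q : Y → Measure (Option X → ℝ)) (Φ : X → Y → ℝ) (zm : Y → Z) (ol ou : Z → ℝ)
    (U V : X → Y → ℝ) (wb wl : Z → ℝ) : Prop :=
  FeasD Φ zm U V wb wl ∧
  ∀ U' V' wb' wl', FeasD Φ zm U' V' wb' wl' →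
    objD n m P Q ol ou U V wb wl ≤ objD n m P Q ol ou U' V' wb' wl'

/-- Legendre–Fenchel conjugate `G*(μ)`. -/
def Gstar (n : X → ℝ) (P : X → Measure (Option Y → ℝ))
    (μ : Option X → Option Y → ℝ) : ℝ :=
  ⨆ U : X → Y → ℝ, (∑ x, ∑ y, μ (some x) (some y) * U x y - Gfun n P U)

/-- Legendre–Fenchel conjugate `H*(μ)`. -/
def Hstar (m : Y → ℝ) (Q : Y → Measure (Option X → ℝ))
    (μ : Option X → Option Y → ℝ) : ℝ :=
  ⨆ V : X → Y → ℝ, (∑ x, ∑ y, μ (some x) (some y) * V x y - Hfun m Q V)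

/-- Social welfare `W(μ) = Σ_{x,y} μ_{xy} Φ_{xy} − G*(μ) − H*(μ)`. -/
def SW (n : X → ℝ) (m : Y → ℝ) (P : X → Measure (Option Y → ℝ))
    (Q : Y → Measure (Option X → ℝ)) (Φ : X → Y → ℝ)
    (μ : Option X → Option Y → ℝ) : ℝ :=
  ∑ x, ∑ y, μ (some x) (some y) * Φ x y - Gstar n P μ - Hstar m Q μ

/-- A feasible matching: nonnegative, satisfying population and regional constraints. -/
def FeasMatch (n : X → ℝ) (m : Y → ℝ) (zm : Y → Z) (ol ou : Z → ℝ)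
    (μ : Option X → Option Y → ℝ) : Prop :=
  (∀ x y, 0 ≤ μ (some x) (some y)) ∧ (∀ x, 0 ≤ μ (some x) none) ∧
  (∀ y, 0 ≤ μ none (some y)) ∧ PopCon n m μ ∧ RegionCon zm ol ou μ


section generic
variable {A : Type*} [Fintype A] [Nonempty A]

def gg (ν : Measure (A → ℝ)) (u : A → ℝ) : ℝ :=
  ∫ ε, (Finset.univ.sup' Finset.univ_nonempty fun a : A => u a + ε a) ∂ν

def pp (ν : Measure (A → ℝ)) (u : A → ℝ) (a : A) : ℝ :=
  (ν {ε | ∀ a', a' ≠ a → u a' + ε a' < u a + ε a}).toReal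

theorem tie_null (u : A → ℝ) (a b : A) (hab : a ≠ b) :
    (volume : Measure (A → ℝ)) {ε | u a + ε a = u b + ε b} = 0 := by
  classical
  by_cases he : ∃ e : A → ℝ, u a + e a = u b + e b
  · obtain ⟨e, he⟩ := he
    let L : (A → ℝ) →ₗ[ℝ] ℝ := LinearMap.proj (R := ℝ) (φ := fun _ : A => ℝ) a - LinearMap.proj (R := ℝ) (φ := fun _ : A => ℝ) b
    have h1 : {ε : A → ℝ | u a + ε a = u b + ε b} =
        (fun ε => ε + (-e)) ⁻¹' (LinearMap.ker L : Set (A → ℝ)) := by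
      ext ε
      simp only [Set.mem_setOf_eq, Set.mem_preimage, SetLike.mem_coe, LinearMap.mem_ker, L,
        LinearMap.sub_apply, LinearMap.proj_apply, Pi.add_apply, Pi.neg_apply]
      constructor <;> intro h <;> linarith
    rw [h1, measure_preimage_add_right]
    apply Measure.addHaar_submodule
    intro htop
    have : (Pi.single a 1 : A → ℝ) ∈ LinearMap.ker L := by rw [htop]; trivial
    simp [L, LinearMap.mem_ker, hab, hab.symm] at this
  · push Not at he
    have : {ε : A → ℝ | u a + ε a = u b + ε b} = ∅ := by
      ext ε; simpa using he ε
    rw [this]; simp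

theorem ae_notie {ν : Measure (A → ℝ)} (hac : ν ≪ volume) (u : A → ℝ) :
    ∀ᵐ ε ∂ν, ∃ a, ∀ a', a' ≠ a → u a' + ε a' < u a + ε a := by
  have h : ∀ᵐ ε ∂ν, ∀ a b : A, a ≠ b → u a + ε a ≠ u b + ε b := by
    rw [ae_all_iff]; intro a
    rw [ae_all_iff]; intro b
    by_cases hab : a = b
    · simp [hab]
    · have := hac (tie_null u a b hab)
      rw [ae_iff]
      simpa [hab] using this
  filter_upwards [h] with ε hε
  obtain ⟨a, ha⟩ := Finite.exists_max (fun a => u a + ε a)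
  exact ⟨a, fun a' h' => lt_of_le_of_ne (ha a') (hε a' a h')⟩

set_option linter.unusedSectionVars false in
theorem pp_meas (u : A → ℝ) (a : A) :
    MeasurableSet {ε : A → ℝ | ∀ a', a' ≠ a → u a' + ε a' < u a + ε a} := by
  rw [Set.ofPred_forall]
  refine MeasurableSet.iInter fun b => ?_
  rw [Set.ofPred_forall]
  refine MeasurableSet.iInter fun _ => ?_
  exact measurableSet_lt (by fun_prop) (by fun_prop)

theorem pp_integral (ν : Measure (A → ℝ)) [IsProbabilityMeasure ν] (hac : ν ≪ volume)
    (u D : A → ℝ) (f : (A → ℝ) → ℝ)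
    (hf : ∀ ε a, (∀ a', a' ≠ a → u a' + ε a' < u a + ε a) → f ε = D a) :
    ∫ ε, f ε ∂ν = ∑ a, D a * pp ν u a := by
  classical
  have h : f =ᵐ[ν] fun ε => ∑ a, D a *
      Set.indicator {ε : A → ℝ | ∀ a', a' ≠ a → u a' + ε a' < u a + ε a} 1 ε := by
    filter_upwards [ae_notie hac u] with ε ⟨a, ha⟩
    rw [hf ε a ha, Finset.sum_eq_single a]
    · rw [Set.indicator_of_mem (by exact ha)]; simp
    · intro b _ hb
      rw [Set.indicator_of_notMem]; simp
      intro h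
      exact lt_asymm (ha b hb) (h a hb.symm)
    · simp
  rw [integral_congr_ae h, integral_finsetSum]
  · refine Finset.sum_congr rfl fun a _ => ?_
    rw [integral_const_mul, integral_indicator_one (pp_meas u a)]; rfl
  · intro a _
    refine Integrable.const_mul ?_ _
    exact (integrable_const (1:ℝ)).indicator (pp_meas u a)

theorem pp_sum (ν : Measure (A → ℝ)) [IsProbabilityMeasure ν] (hac : ν ≪ volume)
    (u : A → ℝ) : ∑ a, pp ν u a = 1 := by
  have := pp_integral ν hac u (fun _ => 1) (fun _ => 1) (fun _ _ _ => rfl)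
  simp at this
  exact this.symm

theorem sup_meas (u : A → ℝ) : Measurable (fun ε : A → ℝ =>
    Finset.univ.sup' Finset.univ_nonempty fun a : A => u a + ε a) := by
  have : Continuous (fun ε : A → ℝ =>
    Finset.univ.sup' Finset.univ_nonempty fun a : A => u a + ε a) := by
    apply Continuous.finset_sup'_apply
    intro i _; fun_prop
  exact this.measurable

theorem sup_le_add (u v ε : A → ℝ) (K : ℝ) (h : ∀ a, u a ≤ v a + K) :
    (Finset.univ.sup' Finset.univ_nonempty fun a : A => u a + ε a) ≤
    (Finset.univ.sup' Finset.univ_nonempty fun a : A => v a + ε a) + K := by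
  apply Finset.sup'_le
  intro a _
  have := Finset.le_sup' (fun a : A => v a + ε a) (Finset.mem_univ a)
  have := h a
  linarith

theorem sup_integrable (ν : Measure (A → ℝ)) [IsProbabilityMeasure ν]
    (hint : Integrable (fun ε : A → ℝ =>
      Finset.univ.sup' Finset.univ_nonempty fun a => |ε a|) ν) (u : A → ℝ) :
    Integrable (fun ε : A → ℝ =>
      Finset.univ.sup' Finset.univ_nonempty fun a : A => u a + ε a) ν := by
  refine Integrable.mono' (hint.add (integrable_const (∑ a, |u a|)))
    (sup_meas u).aestronglyMeasurable ?_
  refine Filter.Eventually.of_forall fun ε => ?_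
  obtain ⟨b, -, hb⟩ := Finset.exists_mem_eq_sup' (Finset.univ_nonempty (α := A))
    (fun a : A => u a + ε a)
  rw [hb, Real.norm_eq_abs]
  have h1 := Finset.le_sup' (fun a : A => |ε a|) (Finset.mem_univ b)
  have h2 := Finset.single_le_sum (f := fun a => |u a|) (fun a _ => abs_nonneg _)
    (Finset.mem_univ b)
  have := abs_add_le (u b) (ε b)
  simp only [Pi.add_apply] at *
  linarith

theorem gg_cont (ν : Measure (A → ℝ)) [IsProbabilityMeasure ν]
    (hint : Integrable (fun ε : A → ℝ =>
      Finset.univ.sup' Finset.univ_nonempty fun a => |ε a|) ν) : Continuous (gg ν) := by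
  have key : ∀ u v, gg ν u ≤ gg ν v + dist u v := by
    intro u v
    have h : gg ν v + dist u v = ∫ ε, ((Finset.univ.sup' Finset.univ_nonempty
        fun a : A => v a + ε a) + dist u v) ∂ν := by
      rw [integral_add (sup_integrable ν hint v) (integrable_const _)]
      simp [gg]
    rw [h]
    refine integral_mono (sup_integrable ν hint u)
      ((sup_integrable ν hint v).add (integrable_const _)) fun ε => ?_
    refine sup_le_add u v ε _ fun a => ?_
    have := dist_le_pi_dist u v a
    rw [Real.dist_eq] at this
    have := le_abs_self (u a - v a)
    linarith
  have : LipschitzWith 1 (gg ν) := LipschitzWith.of_le_add key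
  exact this.continuous

theorem gg_deriv (ν : Measure (A → ℝ)) [IsProbabilityMeasure ν] (hac : ν ≪ volume)
    (hint : Integrable (fun ε : A → ℝ =>
      Finset.univ.sup' Finset.univ_nonempty fun a => |ε a|) ν) (u D : A → ℝ) :
    HasDerivAt (fun t : ℝ => gg ν (fun a => u a + t * D a)) (∑ a, D a * pp ν u a) 0 := by
  classical
  let f : (A → ℝ) → ℝ := fun ε =>
    if h : ∃ a, ∀ a', a' ≠ a → u a' + ε a' < u a + ε a then D h.choose else 0
  have hf : ∀ ε a, (∀ a', a' ≠ a → u a' + ε a' < u a + ε a) → f ε = D a := by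
    intro ε a ha
    have hex : ∃ a, ∀ a', a' ≠ a → u a' + ε a' < u a + ε a := ⟨a, ha⟩
    have : hex.choose = a := by
      by_contra hne
      exact lt_asymm (ha _ hne) (hex.choose_spec a (Ne.symm hne))
    simp only [f, dif_pos hex, this]
  have hfm : AEStronglyMeasurable f ν := by
    have h : f =ᵐ[ν] fun ε => ∑ a, D a *
        Set.indicator {ε : A → ℝ | ∀ a', a' ≠ a → u a' + ε a' < u a + ε a} (fun _ => (1:ℝ)) ε := by
      filter_upwards [ae_notie hac u] with ε ⟨a, ha⟩
      rw [hf ε a ha, Finset.sum_eq_single a]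
      · rw [Set.indicator_of_mem (by exact ha)]; simp
      · intro b _ hb
        rw [Set.indicator_of_notMem]; simp
        intro h
        exact lt_asymm (ha b hb) (h a hb.symm)
      · simp
    refine AEStronglyMeasurable.congr ?_ h.symm
    apply Measurable.aestronglyMeasurable
    refine Finset.measurable_sum _ fun a _ => ?_
    exact (measurable_const.indicator (pp_meas u a)).const_mul _
  rw [← pp_integral ν hac u D f hf]
  refine (hasDerivAt_integral_of_dominated_loc_of_lip (μ := ν) (s := Set.univ)
    (bound := fun _ => ∑ a, |D a|)
    (F := fun (t : ℝ) ε => Finset.univ.sup' Finset.univ_nonempty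
      fun a : A => (u a + t * D a) + ε a) Filter.univ_mem ?_ ?_ hfm ?_ (integrable_const _) ?_).2
  · exact Filter.Eventually.of_forall fun t => (sup_meas _).aestronglyMeasurable
  · exact sup_integrable ν hint _
  · refine Filter.Eventually.of_forall fun ε => ?_
    refine LipschitzOnWith.of_le_add_mul _ fun s _ t _ => ?_
    refine sup_le_add _ _ _ _ fun a => ?_
    rw [Real.coe_nnabs, abs_of_nonneg (Finset.sum_nonneg fun a _ => abs_nonneg _), Real.dist_eq]
    have h2 := Finset.single_le_sum (f := fun a => |D a|) (fun a _ => abs_nonneg _)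
      (Finset.mem_univ a)
    have h3 : (s - t) * D a ≤ |D a| * |s - t| := by
      rw [mul_comm |D a|, ← abs_mul]; exact le_abs_self _
    have h4 := mul_le_mul_of_nonneg_right h2 (abs_nonneg (s - t))
    linarith
  · filter_upwards [ae_notie hac u] with ε ⟨a, ha⟩
    rw [hf ε a ha]
    have h1 : HasDerivAt (fun t : ℝ => (u a + t * D a) + ε a) (D a) 0 := by
      simpa using (((hasDerivAt_id (0:ℝ)).mul_const (D a)).const_add (u a)).add_const (ε a)
    refine h1.congr_of_eventuallyEq ?_
    have h2 : ∀ᶠ t : ℝ in nhds 0, ∀ a', a' ≠ a →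
        (u a' + t * D a') + ε a' < (u a + t * D a) + ε a := by
      rw [Filter.eventually_all]; intro b
      by_cases hb : b = a
      · simp [hb]
      · have : ∀ᶠ t : ℝ in nhds 0, (u b + t * D b) + ε b < (u a + t * D a) + ε a := by
          apply ContinuousAt.eventually_lt (by fun_prop) (by fun_prop)
          simpa using ha b hb
        filter_upwards [this] with t ht _ using ht
    filter_upwards [h2] with t ht
    apply le_antisymm
    · apply Finset.sup'_le
      intro b _
      by_cases hb : b = a
      · rw [hb]
      · exact (ht b hb).le
    · exact Finset.le_sup' (fun a => (u a + t * D a) + ε a) (Finset.mem_univ a)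

/-- coercivity -/
theorem gg_coer (ν : Measure (A → ℝ)) [IsProbabilityMeasure ν]
    (hint : Integrable (fun ε : A → ℝ =>
      Finset.univ.sup' Finset.univ_nonempty fun a => |ε a|) ν)
    (p : A → ℝ) (hp : ∀ a, 0 < p a) (o : A) :
    ∃ C δ : ℝ, 0 < δ ∧ ∀ u : A → ℝ, u o = 0 → ∀ b,
      ∑ a, p a * u a + δ * |u b| - C ≤ (∑ a, p a) * gg ν u := by
  classical
  set N := ∑ a, p a with hN
  have hNpos : 0 < N := Finset.sum_pos (fun a _ => hp a) Finset.univ_nonempty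
  obtain ⟨a0, ha0⟩ := Finite.exists_min p
  set K := ∫ ε, (Finset.univ.sup' Finset.univ_nonempty fun a => |ε a|) ∂ν with hK
  refine ⟨N * K, p a0, hp a0, fun u hu b => ?_⟩
  obtain ⟨c, hc⟩ := Finite.exists_max u
  have h1 : u c - K ≤ gg ν u := by
    have : u c - K = ∫ ε, (u c - (Finset.univ.sup' Finset.univ_nonempty fun a => |ε a|)) ∂ν := by
      rw [integral_sub (integrable_const _) hint]; simp [hK]
    rw [this]
    refine integral_mono ((integrable_const _).sub hint) (sup_integrable ν hint u) fun ε => ?_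
    have h1 := Finset.le_sup' (fun a : A => |ε a|) (Finset.mem_univ c)
    have h2 := Finset.le_sup' (fun a : A => u a + ε a) (Finset.mem_univ c)
    have := neg_abs_le (ε c)
    simp only at *
    linarith
  have h2 := mul_le_mul_of_nonneg_left h1 hNpos.le
  have h3 : p a0 * |u b| ≤ ∑ a, p a * (u c - u a) := by
    have hnn : ∀ a ∈ Finset.univ, 0 ≤ p a * (u c - u a) := fun a _ =>
      mul_nonneg (hp a).le (sub_nonneg.2 (hc a))
    have hb := Finset.single_le_sum hnn (Finset.mem_univ b)
    have ho := Finset.single_le_sum hnn (Finset.mem_univ o)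
    have hcb := hc b
    have hco := hc o
    have e1 := mul_le_mul_of_nonneg_right (ha0 b) (sub_nonneg.2 hcb)
    have e2 := mul_le_mul_of_nonneg_right (ha0 o) (sub_nonneg.2 hco)
    have hpa := hp a0
    simp only [hu] at *
    rcases abs_cases (u b) with ⟨h, _⟩ | ⟨h, _⟩ <;> rw [h] <;> nlinarith
  have h4 : ∑ a, p a * (u c - u a) = N * u c - ∑ a, p a * u a := by
    rw [hN, Finset.sum_mul, ← Finset.sum_sub_distrib]
    exact Finset.sum_congr rfl fun a _ => by ring
  nlinarith
end generic

section sides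
variable {I A : Type*} [Fintype I] [Fintype A] [Nonempty I]

def hat0 (u : A → ℝ) (o : Option A) : ℝ := o.elim 0 u

def SS (N : I → ℝ) (ν : I → Measure (Option A → ℝ)) (U : I → A → ℝ) : ℝ :=
  ∑ i, N i * gg (ν i) (hat0 (U i))

set_option linter.unusedSectionVars false in
theorem SS_cont (N : I → ℝ) (ν : I → Measure (Option A → ℝ)) [∀ i, IsProbabilityMeasure (ν i)]
    (hint : ∀ i, Integrable (fun ε : Option A → ℝ =>
      Finset.univ.sup' Finset.univ_nonempty fun a => |ε a|) (ν i)) :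
    Continuous (SS N ν) := by
  unfold SS
  refine continuous_finsetSum _ fun i _ => ?_
  refine continuous_const.mul ((gg_cont (ν i) (hint i)).comp ?_)
  refine continuous_pi fun o => ?_
  cases o with
  | none => exact continuous_const
  | some a => simp only [hat0, Option.elim]; fun_prop

set_option linter.unusedSectionVars false in
theorem SS_deriv (N : I → ℝ) (ν : I → Measure (Option A → ℝ)) [∀ i, IsProbabilityMeasure (ν i)]
    (hac : ∀ i, ν i ≪ volume)
    (hint : ∀ i, Integrable (fun ε : Option A → ℝ =>
      Finset.univ.sup' Finset.univ_nonempty fun a => |ε a|) (ν i)) (U D : I → A → ℝ) :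
    HasDerivAt (fun t : ℝ => SS N ν (fun i a => U i a + t * D i a))
      (∑ i, ∑ a, D i a * (N i * pp (ν i) (hat0 (U i)) (some a))) 0 := by
  unfold SS
  refine HasDerivAt.fun_sum fun i _ => ?_
  have h := (gg_deriv (ν i) (hac i) (hint i) (hat0 (U i)) (hat0 (D i))).const_mul (N i)
  have e1 : ∀ t : ℝ, hat0 (fun a => U i a + t * D i a) =
      fun o => hat0 (U i) o + t * hat0 (D i) o := by
    intro t; funext o; cases o <;> simp [hat0]
  simp only [e1]
  have e2 : ∑ a, D i a * (N i * pp (ν i) (hat0 (U i)) (some a)) =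
      N i * ∑ o, hat0 (D i) o * pp (ν i) (hat0 (U i)) o := by
    rw [Fintype.sum_option]
    simp only [hat0, Option.elim, zero_mul, zero_add, Finset.mul_sum]
    exact Finset.sum_congr rfl fun a _ => by ring
  rw [e2]
  exact h

theorem SS_coer (N : I → ℝ) (ν : I → Measure (Option A → ℝ)) [∀ i, IsProbabilityMeasure (ν i)]
    (hint : ∀ i, Integrable (fun ε : Option A → ℝ =>
      Finset.univ.sup' Finset.univ_nonempty fun a => |ε a|) (ν i))
    (p : I → Option A → ℝ) (hp : ∀ i o, 0 < p i o) (hN : ∀ i, ∑ o, p i o = N i) :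
    ∃ C δ : ℝ, 0 < δ ∧ ∀ U : I → A → ℝ, ∀ i a,
      ∑ i, ∑ a, p i (some a) * U i a + δ * |U i a| - C ≤ SS N ν U := by
  choose C δ hδ h using fun i => gg_coer (ν i) (hint i) (p i) (hp i) none
  obtain ⟨j, hj⟩ := Finite.exists_min δ
  refine ⟨∑ i, C i, δ j, hδ j, fun U i a => ?_⟩
  have h1 : ∑ k, (∑ b, p k (some b) * U k b + δ k * |U k a| - C k) ≤ SS N ν U := by
    refine Finset.sum_le_sum fun k _ => ?_
    have := h k (hat0 (U k)) rfl (some a)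
    rw [hN, Fintype.sum_option] at this
    simpa [hat0] using this
  rw [Finset.sum_sub_distrib, Finset.sum_add_distrib] at h1
  have h2 := Finset.single_le_sum (f := fun k => δ k * |U k a|)
    (fun k _ => mul_nonneg (hδ k).le (abs_nonneg _)) (Finset.mem_univ i)
  have h3 := mul_le_mul_of_nonneg_right (hj i) (abs_nonneg (U i a))
  linarith
end sides

theorem right_deriv_nonneg {f : ℝ → ℝ} {d : ℝ} (hf : HasDerivAt f d 0)
    (h : ∀ t, 0 < t → f 0 ≤ f t) : 0 ≤ d := by
  have h1 := hf.tendsto_slope_zero_right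
  refine ge_of_tendsto h1 ?_
  filter_upwards [self_mem_nhdsWithin] with t ht
  have ht : 0 < t := ht
  have := h t ht
  simp only [zero_add, smul_eq_mul]
  exact mul_nonneg (inv_nonneg.2 ht.le) (by linarith)

theorem left_deriv_nonpos {f : ℝ → ℝ} {d : ℝ} (hf : HasDerivAt f d 0)
    (h : ∀ t, t < 0 → f 0 ≤ f t) : d ≤ 0 := by
  have h1 : HasDerivAt (fun t => f (-t)) (-d) 0 := by
    have hf' : HasDerivAt f d (-0) := by simpa using hf
    simpa [Function.comp_def] using hf'.comp (0:ℝ) (hasDerivAt_neg (0:ℝ))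
  have := right_deriv_nonneg h1 (fun t ht => by simpa using h (-t) (by linarith))
  linarith

theorem one_dim {f : ℝ → ℝ} {R w a b : ℝ} (hab : a ≤ b) (hf : HasDerivAt f (-R) 0)
    (h : ∀ t, f 0 + (b * max w 0 + a * min w 0) ≤ f t + (b * max (w + t) 0 + a * min (w + t) 0)) :
    (a ≤ R ∧ R ≤ b) ∧ (0 < w → R = b) ∧ (w < 0 → R = a) := by
  have hd : ∀ c : ℝ, HasDerivAt (fun t => f t + c * t) (-R + c) 0 := fun c => by
    have := hf.fun_add ((hasDerivAt_id (0:ℝ)).const_mul c)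
    rw [mul_one] at this
    exact this
  have hb : R ≤ b := by
    have := right_deriv_nonneg (hd b) fun t ht => by
      have := h t
      rcases le_total w 0 with h1 | h1 <;> rcases le_total (w + t) 0 with h2 | h2 <;>
        simp only [h1, h2, max_eq_left, max_eq_right, min_eq_left, min_eq_right] at this <;>
        nlinarith
    linarith
  have ha : a ≤ R := by
    have := left_deriv_nonpos (hd a) fun t ht => by
      have := h t
      rcases le_total w 0 with h1 | h1 <;> rcases le_total (w + t) 0 with h2 | h2 <;>
        simp only [h1, h2, max_eq_left, max_eq_right, min_eq_left, min_eq_right] at this <;>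
        nlinarith
    linarith
  refine ⟨⟨ha, hb⟩, fun hw => ?_, fun hw => ?_⟩
  · have : IsLocalMin (fun t => f t + b * t) 0 := by
      have : ∀ᶠ t : ℝ in nhds 0, -w < t := eventually_gt_nhds (by linarith)
      filter_upwards [this] with t ht
      have := h t
      rw [max_eq_left hw.le, min_eq_right hw.le, max_eq_left (by linarith),
        min_eq_right (by linarith)] at this
      linarith
    have := this.hasDerivAt_eq_zero (hd b)
    linarith
  · have : IsLocalMin (fun t => f t + a * t) 0 := by
      have : ∀ᶠ t : ℝ in nhds 0, t < -w := eventually_lt_nhds (by linarith)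
      filter_upwards [this] with t ht
      have := h t
      rw [max_eq_right hw.le, min_eq_left hw.le, max_eq_right (by linarith),
        min_eq_left (by linarith)] at this
      linarith
    have := this.hasDerivAt_eq_zero (hd a)
    linarith

/-- the reduced dual objective -/
def FF (n : X → ℝ) (m : Y → ℝ) (P : X → Measure (Option Y → ℝ))
    (Q : Y → Measure (Option X → ℝ)) (Φ : X → Y → ℝ) (zm : Y → Z) (ol ou : Z → ℝ)
    (e : (X → Y → ℝ) × (Z → ℝ)) : ℝ :=
  SS n P e.1 + SS m Q (fun y x => Φ x y - e.2 (zm y) - e.1 x y) +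
    ∑ z, (ou z * max (e.2 z) 0 + ol z * min (e.2 z) 0)

theorem exists_min_FF
    (n : X → ℝ) (m : Y → ℝ)
    (P : X → Measure (Option Y → ℝ)) (Q : Y → Measure (Option X → ℝ))
    [∀ x, IsProbabilityMeasure (P x)] [∀ y, IsProbabilityMeasure (Q y)]
    (hPint : ∀ x, Integrable (fun ε : Option Y → ℝ =>
      Finset.univ.sup' Finset.univ_nonempty fun a => |ε a|) (P x))
    (hQint : ∀ y, Integrable (fun η : Option X → ℝ =>
      Finset.univ.sup' Finset.univ_nonempty fun a => |η a|) (Q y))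
    (Φ : X → Y → ℝ) (zm : Y → Z) (ol ou : Z → ℝ)
    (μ₀ : Option X → Option Y → ℝ)
    (hpos : (∀ x y, 0 < μ₀ (some x) (some y)) ∧ (∀ x, 0 < μ₀ (some x) none) ∧
      (∀ y, 0 < μ₀ none (some y)))
    (hpop : PopCon n m μ₀) (hreg : RegionCon zm ol ou μ₀)
    (hz : ∀ z, (∀ y, zm y ≠ z) → ol z ≤ -1 ∧ 1 ≤ ou z) :
    ∃ e, ∀ e', FF n m P Q Φ zm ol ou e ≤ FF n m P Q Φ zm ol ou e' := by
  have hcont : Continuous (FF n m P Q Φ zm ol ou) := by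
    unfold FF
    refine ((SS_cont n P hPint).comp continuous_fst |>.add
      ((SS_cont m Q hQint).comp ?_)).add ?_ <;> fun_prop
  obtain ⟨C, δ, hδ, hC⟩ := SS_coer n P hPint (fun x o => μ₀ (some x) o)
    (by intro x o; cases o; exacts [hpos.2.1 x, hpos.1 x _]) hpop.1
  obtain ⟨C', δ', hδ', hC'⟩ := SS_coer m Q hQint (fun y o => μ₀ o (some y))
    (by intro y o; cases o; exacts [hpos.2.2 y, hpos.1 _ y]) hpop.2
  set M : X → Y → ℝ := fun x y => μ₀ (some x) (some y) with hM
  set K := ∑ x, ∑ y, M x y * Φ x y - C - C' with hK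
  have key : ∀ (U : X → Y → ℝ) (w : Z → ℝ) x y z,
      K + δ * |U x y| + δ' * |Φ x y - w (zm y) - U x y| +
        (ou z * max (w z) 0 + ol z * min (w z) 0 - w z * regionMass zm μ₀ z)
        ≤ FF n m P Q Φ zm ol ou (U, w) := by
    intro U w x y z
    have h1 := hC U x y
    have h2 := hC' (fun y x => Φ x y - w (zm y) - U x y) y x
    have h3 : ∑ y, ∑ x, M x y * (Φ x y - w (zm y) - U x y) =
        ∑ x, ∑ y, M x y * Φ x y - ∑ z, w z * regionMass zm μ₀ z - ∑ x, ∑ y, M x y * U x y := by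
      have h4 : ∑ z, w z * regionMass zm μ₀ z = ∑ x, ∑ y, M x y * w (zm y) := by
        unfold regionMass
        simp only [Finset.mul_sum]
        rw [Finset.sum_comm]
        refine Finset.sum_congr rfl fun x _ => ?_
        rw [Finset.sum_comm]
        refine Finset.sum_congr rfl fun y _ => ?_
        simp [hM, mul_comm]
      rw [h4, Finset.sum_comm]
      simp only [← Finset.sum_sub_distrib]
      refine Finset.sum_congr rfl fun x _ => Finset.sum_congr rfl fun y _ => by ring
    have h5 := Finset.single_le_sum
      (f := fun z => ou z * max (w z) 0 + ol z * min (w z) 0 - w z * regionMass zm μ₀ z)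
      (s := Finset.univ) (fun z _ => by
        obtain ⟨ha, hb⟩ := hreg z
        rcases le_total (w z) 0 with h | h
        · rw [max_eq_right h, min_eq_left h]; nlinarith
        · rw [max_eq_left h, min_eq_right h]; nlinarith) (Finset.mem_univ z)
    rw [Finset.sum_sub_distrib] at h5
    simp only [FF]
    simp only [hM] at *
    linarith
  have hψ : ∀ (w : Z → ℝ) z,
      0 ≤ ou z * max (w z) 0 + ol z * min (w z) 0 - w z * regionMass zm μ₀ z := by
    intro w z
    obtain ⟨ha, hb⟩ := hreg z
    rcases le_total (w z) 0 with h | h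
    · rw [max_eq_right h, min_eq_left h]; nlinarith
    · rw [max_eq_left h, min_eq_right h]; nlinarith
  have hψ' : ∀ (w : Z → ℝ) z, (∀ y, zm y ≠ z) →
      |w z| ≤ ou z * max (w z) 0 + ol z * min (w z) 0 - w z * regionMass zm μ₀ z := by
    intro w z hzz
    have hR : regionMass zm μ₀ z = 0 := by simp [regionMass, hzz]
    obtain ⟨ha, hb⟩ := hz z hzz
    rw [hR]
    rcases le_total (w z) 0 with h | h
    · rw [max_eq_right h, min_eq_left h, abs_of_nonpos h]; nlinarith
    · rw [max_eq_left h, min_eq_right h, abs_of_nonneg h]; nlinarith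
  obtain ⟨x0⟩ := ‹Nonempty X›
  obtain ⟨y0⟩ := ‹Nonempty Y›
  refine hcont.exists_forall_le_of_isBounded (0, 0) ?_
  set B := FF n m P Q Φ zm ol ou (0, 0) with hB
  obtain ⟨T, hT⟩ : ∃ T, T = |B - K| / δ + |B - K| / δ' + |B - K| + ∑ x, ∑ y, |Φ x y| := ⟨_, rfl⟩
  have hpos1 : 0 ≤ |B - K| / δ := by positivity
  have hpos2 : 0 ≤ |B - K| / δ' := by positivity
  have hpos3 : 0 ≤ ∑ x, ∑ y, |Φ x y| := by positivity
  have hpos4 := abs_nonneg (B - K)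
  have hTpos : 0 ≤ T := by rw [hT]; positivity
  refine (Metric.isBounded_closedBall (x := ((0, 0) : (X → Y → ℝ) × (Z → ℝ))) (r := T)).subset ?_
  rintro ⟨U, w⟩ hUw
  have hUw : FF n m P Q Φ zm ol ou (U, w) ≤ B := hUw
  have hle := le_abs_self (B - K)
  have hU : ∀ x y, |U x y| ≤ |B - K| / δ := by
    intro x y
    rw [le_div_iff₀ hδ]
    have h1 := key U w x y (zm y)
    have h2 := hψ w (zm y)
    have h3 := mul_nonneg hδ'.le (abs_nonneg (Φ x y - w (zm y) - U x y))
    linarith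
  have hV : ∀ x y, |Φ x y - w (zm y) - U x y| ≤ |B - K| / δ' := by
    intro x y
    rw [le_div_iff₀ hδ']
    have h1 := key U w x y (zm y)
    have h2 := hψ w (zm y)
    have h3 := mul_nonneg hδ.le (abs_nonneg (U x y))
    linarith
  have hw : ∀ z, |w z| ≤ T := by
    intro z
    by_cases hzz : ∀ y, zm y ≠ z
    · have h1 := key U w x0 y0 z
      have h2 := hψ' w z hzz
      have h3 := mul_nonneg hδ.le (abs_nonneg (U x0 y0))
      have h4 := mul_nonneg hδ'.le (abs_nonneg (Φ x0 y0 - w (zm y0) - U x0 y0))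
      linarith
    · push Not at hzz
      obtain ⟨y, rfl⟩ := hzz
      have h1 := hU x0 y
      have h2 := hV x0 y
      have h3 : |Φ x0 y| ≤ ∑ x, ∑ y, |Φ x y| := by
        refine (Finset.single_le_sum (f := fun y => |Φ x0 y|) (fun _ _ => abs_nonneg _)
          (Finset.mem_univ y)).trans ?_
        exact Finset.single_le_sum (f := fun x => ∑ y, |Φ x y|)
          (fun _ _ => Finset.sum_nonneg fun _ _ => abs_nonneg _) (Finset.mem_univ x0)
      rw [abs_le] at *
      constructor <;> linarith [h1.1, h1.2, h2.1, h2.2, h3.1, h3.2]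
  rw [mem_closedBall_iff_norm]
  simp only [Prod.mk_sub_mk, sub_zero, Prod.norm_def, max_le_iff]
  constructor
  · rw [pi_norm_le_iff_of_nonneg hTpos]; intro x
    rw [pi_norm_le_iff_of_nonneg hTpos]; intro y
    rw [Real.norm_eq_abs]
    linarith [hU x y]
  · rw [pi_norm_le_iff_of_nonneg hTpos]; intro z
    rw [Real.norm_eq_abs]
    exact hw z

theorem core
    (n : X → ℝ) (m : Y → ℝ)
    (P : X → Measure (Option Y → ℝ)) (Q : Y → Measure (Option X → ℝ))
    [∀ x, IsProbabilityMeasure (P x)] [∀ y, IsProbabilityMeasure (Q y)]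
    (hPac : ∀ x, P x ≪ (volume : Measure (Option Y → ℝ)))
    (hQac : ∀ y, Q y ≪ (volume : Measure (Option X → ℝ)))
    (hPint : ∀ x, Integrable (fun ε : Option Y → ℝ =>
      Finset.univ.sup' Finset.univ_nonempty fun a => |ε a|) (P x))
    (hQint : ∀ y, Integrable (fun η : Option X → ℝ =>
      Finset.univ.sup' Finset.univ_nonempty fun a => |η a|) (Q y))
    (Φ : X → Y → ℝ) (zm : Y → Z) (ol ou : Z → ℝ)
    (hou : ∀ z, ol z ≤ ou z)
    (μ₀ : Option X → Option Y → ℝ)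
    (hpos : (∀ x y, 0 < μ₀ (some x) (some y)) ∧ (∀ x, 0 < μ₀ (some x) none) ∧
      (∀ y, 0 < μ₀ none (some y)))
    (hpop : PopCon n m μ₀) (hreg : RegionCon zm ol ou μ₀)
    (hz : ∀ z, (∀ y, zm y ≠ z) → ol z ≤ -1 ∧ 1 ≤ ou z) :
    ∃ (μ : Option X → Option Y → ℝ) (U V : X → Y → ℝ) (w : Z → ℝ),
      IsEAE n m P Q Φ zm ol ou μ U V w := by
  obtain ⟨⟨U, w⟩, hmin⟩ := exists_min_FF n m P Q hPint hQint Φ zm ol ou μ₀ hpos hpop hreg hz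
  set V : X → Y → ℝ := fun x y => Φ x y - w (zm y) - U x y with hV
  have hclear : ∀ x y, n x * cp P U x (some y) = m y * cq Q V y (some x) := by
    set D : X → Y → ℝ := fun x y => n x * cp P U x (some y) - m y * cq Q V y (some x) with hD
    have h1 := SS_deriv n P hPac hPint U D
    have h2 := SS_deriv m Q hQac hQint (fun y x => V x y) (fun y x => - D x y)
    have h3 := h1.fun_add h2
    have h4 : IsLocalMin (fun t : ℝ => SS n P (fun i a => U i a + t * D i a) +
        SS m Q (fun i a => V a i + t * - D a i)) 0 := by
      refine Filter.Eventually.of_forall fun t => ?_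
      have := hmin (fun i a => U i a + t * D i a, w)
      simp only [FF] at this
      have e : (fun y x => Φ x y - w (zm y) - (U x y + t * D x y)) =
          (fun (y : Y) (x : X) => V x y + t * - D x y) := by
        funext y x; simp only [hV]; ring
      rw [e] at this
      simp only [zero_mul, add_zero]
      linarith
    have h5 := h4.hasDerivAt_eq_zero h3
    rw [Finset.sum_comm (s := (Finset.univ : Finset Y)), ← Finset.sum_add_distrib] at h5
    simp only [← Finset.sum_add_distrib] at h5
    have h6 : ∑ x, ∑ y, D x y ^ 2 = 0 := by
      rw [← h5]
      refine Finset.sum_congr rfl fun x _ => Finset.sum_congr rfl fun y _ => ?_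
      have : D x y = n x * pp (P x) (hat0 (U x)) (some y) -
        m y * pp (Q y) (hat0 (fun x => V x y)) (some x) := rfl
      rw [pow_two]
      nth_rw 2 [this]
      ring
    intro x y
    rw [Finset.sum_eq_zero_iff_of_nonneg
      (fun _ _ => Finset.sum_nonneg fun _ _ => sq_nonneg _)] at h6
    have h7 := h6 x (Finset.mem_univ x)
    rw [Finset.sum_eq_zero_iff_of_nonneg (fun _ _ => sq_nonneg _)] at h7
    have h8 := h7 y (Finset.mem_univ y)
    have h9 : D x y = 0 := by simpa using h8
    simp only [hD] at h9
    linarith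
  let μ : Option X → Option Y → ℝ := fun a b =>
    match a, b with
    | some x, some y => n x * cp P U x (some y)
    | some x, none => n x * cp P U x none
    | none, some y => m y * cq Q V y none
    | none, none => 0
  have hw : ∀ z, (ol z ≤ regionMass zm μ z ∧ regionMass zm μ z ≤ ou z) ∧
      (0 < w z → regionMass zm μ z = ou z) ∧ (w z < 0 → regionMass zm μ z = ol z) := by
    intro z
    have h1 := SS_deriv m Q hQac hQint (fun y x => V x y)
      (fun y _ => - (if zm y = z then (1:ℝ) else 0))
    have e : (∑ y, ∑ x, -(if zm y = z then (1:ℝ) else 0) *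
        (m y * pp (Q y) (hat0 (fun x => V x y)) (some x))) = - regionMass zm μ z := by
      unfold regionMass
      rw [Finset.sum_comm, ← Finset.sum_neg_distrib]
      refine Finset.sum_congr rfl fun x _ => ?_
      rw [← Finset.sum_neg_distrib]
      refine Finset.sum_congr rfl fun y _ => ?_
      have : μ (some x) (some y) = m y * pp (Q y) (hat0 (fun x => V x y)) (some x) :=
        hclear x y
      rw [this]
      split_ifs <;> simp
    rw [e] at h1
    refine one_dim (hou z) h1 fun t => ?_
    have := hmin (U, fun z' => w z' + t * (if z' = z then 1 else 0))
    simp only [FF] at this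
    have e2 : (fun y x => Φ x y - (w (zm y) + t * (if zm y = z then 1 else 0)) - U x y) =
        (fun (y : Y) (x : X) => V x y + t * - (if zm y = z then (1:ℝ) else 0)) := by
      funext y x; simp only [hV]; ring
    rw [e2, ← Finset.add_sum_erase _ _ (Finset.mem_univ z),
      ← Finset.add_sum_erase _ _ (Finset.mem_univ z)] at this
    have e3 : ∑ z' ∈ Finset.univ.erase z, (ou z' * max (w z' + t * (if z' = z then 1 else 0)) 0 +
        ol z' * min (w z' + t * (if z' = z then 1 else 0)) 0) =
        ∑ z' ∈ Finset.univ.erase z, (ou z' * max (w z') 0 + ol z' * min (w z') 0) := by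
      refine Finset.sum_congr rfl fun z' hz' => ?_
      rw [if_neg (Finset.ne_of_mem_erase hz')]; simp
    rw [e3] at this
    simp only [if_true, mul_one] at this
    simp only [zero_mul, add_zero]
    linarith
  refine ⟨μ, U, V, w, ⟨⟨?_, ?_⟩, ?_, ⟨?_, ?_, ?_⟩, fun z => (hw z).1⟩, fun z => (hw z).2⟩
  · intro x
    have h1 : ∑ o, cp P U x o = 1 := pp_sum (P x) (hPac x) (Uhat U x)
    have h2 : ∀ o, μ (some x) o = n x * cp P U x o := by intro o; cases o <;> rfl
    simp only [h2, ← Finset.mul_sum, h1, mul_one]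
  · intro y
    have h1 : ∑ o, cq Q V y o = 1 := pp_sum (Q y) (hQac y) (Vhat V y)
    have h2 : ∀ o, μ o (some y) = m y * cq Q V y o := by
      intro o; cases o; exacts [rfl, hclear _ _]
    simp only [h2, ← Finset.mul_sum, h1, mul_one]
  · intro x y
    simp only [hV]; linarith
  · intro x y
    exact ⟨rfl, hclear x y⟩
  · intro x; rfl
  · intro y; rfl

/-- Existence part of Corollary 1. If the regional constraints are
strictly feasible, an efficient aggregate equilibrium exists. -/
theorem stmt13
    (n : X → ℝ) (m : Y → ℝ) (hn : ∀ x, 0 < n x) (hm : ∀ y, 0 < m y)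
    (P : X → Measure (Option Y → ℝ)) (Q : Y → Measure (Option X → ℝ))
    [∀ x, IsProbabilityMeasure (P x)] [∀ y, IsProbabilityMeasure (Q y)]
    (hPac : ∀ x, P x ≪ (volume : Measure (Option Y → ℝ)))
    (hPpos : ∀ x, (volume : Measure (Option Y → ℝ)) ≪ P x)
    (hQac : ∀ y, Q y ≪ (volume : Measure (Option X → ℝ)))
    (hQpos : ∀ y, (volume : Measure (Option X → ℝ)) ≪ Q y)
    (hPint : ∀ x, Integrable (fun ε : Option Y → ℝ =>
      Finset.univ.sup' Finset.univ_nonempty fun a => |ε a|) (P x))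
    (hQint : ∀ y, Integrable (fun η : Option X → ℝ =>
      Finset.univ.sup' Finset.univ_nonempty fun a => |η a|) (Q y))
    (Φ : X → Y → ℝ) (zm : Y → Z) (ol ou : Z → ℝ)
    (hol : ∀ z, 0 ≤ ol z) (hou : ∀ z, ol z ≤ ou z)
    -- strict feasibility of the constraints
    (μ₀ : Option X → Option Y → ℝ)
    (hpos : (∀ x y, 0 < μ₀ (some x) (some y)) ∧ (∀ x, 0 < μ₀ (some x) none) ∧
      (∀ y, 0 < μ₀ none (some y)))
    (hpop : PopCon n m μ₀) (hreg : RegionCon zm ol ou μ₀) :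
    ∃ (μ : Option X → Option Y → ℝ) (U V : X → Y → ℝ) (w : Z → ℝ),
      IsEAE n m P Q Φ zm ol ou μ U V w := by
  classical
  obtain ⟨μ, U, V, w, ⟨h1, h2, h3, h4⟩, h5⟩ := core n m P Q hPac hQac hPint hQint Φ zm
    (fun z => if ∀ y, zm y ≠ z then -1 else ol z) (fun z => if ∀ y, zm y ≠ z then 1 else ou z)
    (by intro z; split_ifs; exacts [by norm_num, hou z]) μ₀ hpos hpop
    (by
      intro z
      dsimp only
      split_ifs with h
      · have : regionMass zm μ₀ z = 0 := by simp [regionMass, h]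
        rw [this]; norm_num
      · exact hreg z)
    (by intro z h; simp only [if_pos h]; exact ⟨le_rfl, le_rfl⟩)
  refine ⟨μ, U, V, w, ⟨h1, h2, h3, fun z => ?_⟩, fun z => ?_⟩
  · by_cases h : ∀ y, zm y ≠ z
    · have e0 : regionMass zm μ₀ z = 0 := by simp [regionMass, h]
      have e1 : regionMass zm μ z = 0 := by simp [regionMass, h]
      have := hreg z
      rwa [e0, ← e1] at this
    · have := h4 z
      simp only [if_neg h] at this
      exact this
  · by_cases h : ∀ y, zm y ≠ z
    · have e1 : regionMass zm μ z = 0 := by simp [regionMass, h]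
      have := h5 z
      simp only [if_pos h, e1] at this
      constructor
      · intro hw; have := this.1 hw; norm_num at this
      · intro hw; have := this.2 hw; norm_num at this
    · have := h5 z
      simp only [if_neg h] at this
      exact this

end
end
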